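/- For every prime p, the number of subgroups of ℤ³ of index p² equals 1 + p + 2p² + p³ + p⁴. -/

import Mathlib

namespace AddSubgroup

variable {A B : Type*} [AddCommGroup A] [AddCommGroup B]

theorem index_eq_index_comap_inl_mul_index_map_snd (H : AddSubgroup (A × B)) :
    H.index = (H.comap (AddMonoidHom.inl A B)).index * (H.map (AddMonoidHom.snd A B)).index := by
  have hker : (AddMonoidHom.inl A B).range = (AddMonoidHom.snd A B).ker := by
    ext ⟨a, b⟩
    simp only [AddMonoidHom.mem_range, AddMonoidHom.mem_ker, AddMonoidHom.inl_apply,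
      AddMonoidHom.coe_snd, Prod.mk.injEq, exists_eq_left, eq_comm (a := b)]
  have hrange : (AddMonoidHom.snd A B).range = ⊤ :=
    AddMonoidHom.range_eq_top.2 Prod.snd_surjective
  rw [index_map, hrange, index_top, mul_one, index_comap, hker,
    ← relIndex_mul_index (le_sup_left : H ≤ H ⊔ (AddMonoidHom.snd A B).ker),
    relIndex_sup_left]

/-- The subgroup of `A × ℤ` generated by `K × 0` and `(x, e)`, where `x` is any lift of `q`. -/
def extendByInt (K : AddSubgroup A) (e : ℕ) (q : A ⧸ K) : AddSubgroup (A × ℤ) where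
  carrier := {x | ∃ k : ℤ, x.2 = k * e ∧ (x.1 : A ⧸ K) = k • q}
  zero_mem' := ⟨0, by simp⟩
  add_mem' := by
    rintro ⟨a, z⟩ ⟨b, w⟩ ⟨k, hk, hk'⟩ ⟨l, hl, hl'⟩
    refine ⟨k + l, ?_, ?_⟩
    · simp_all [add_mul]
    · simp_all [add_smul]
  neg_mem' := by
    rintro ⟨a, z⟩ ⟨k, hk, hk'⟩
    exact ⟨-k, by simp_all, by simp_all⟩

theorem mem_extendByInt {K : AddSubgroup A} {e : ℕ} {q : A ⧸ K} {x : A × ℤ} :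
    x ∈ extendByInt K e q ↔ ∃ k : ℤ, x.2 = k * e ∧ (x.1 : A ⧸ K) = k • q := Iff.rfl

theorem comap_inl_extendByInt (K : AddSubgroup A) {e : ℕ} (he : e ≠ 0) (q : A ⧸ K) :
    (extendByInt K e q).comap (AddMonoidHom.inl A ℤ) = K := by
  ext a
  simp only [mem_comap, AddMonoidHom.inl_apply, mem_extendByInt]
  constructor
  · rintro ⟨k, hk, hk'⟩
    obtain rfl : k = 0 := by simpa [he] using hk.symm
    simpa [QuotientAddGroup.eq_zero_iff] using hk'
  · intro ha
    exact ⟨0, by simp, by simpa [QuotientAddGroup.eq_zero_iff] using ha⟩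

theorem map_snd_extendByInt (K : AddSubgroup A) (e : ℕ) (q : A ⧸ K) :
    (extendByInt K e q).map (AddMonoidHom.snd A ℤ) = zmultiples (e : ℤ) := by
  ext z
  simp only [mem_map, AddMonoidHom.coe_snd, mem_extendByInt, mem_zmultiples_iff, smul_eq_mul]
  constructor
  · rintro ⟨x, ⟨k, hk, -⟩, rfl⟩
    exact ⟨k, hk.symm⟩
  · rintro ⟨k, rfl⟩
    obtain ⟨a, ha⟩ := QuotientAddGroup.mk_surjective (k • q)
    exact ⟨(a, k * e), ⟨k, rfl, ha⟩, rfl⟩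

theorem index_extendByInt (K : AddSubgroup A) {e : ℕ} (he : e ≠ 0) (q : A ⧸ K) :
    (extendByInt K e q).index = K.index * e := by
  rw [index_eq_index_comap_inl_mul_index_map_snd, comap_inl_extendByInt K he,
    map_snd_extendByInt, Int.index_zmultiples, Int.natAbs_natCast]

theorem mk_mem_extendByInt_iff {K : AddSubgroup A} {e : ℕ} (he : e ≠ 0) {q : A ⧸ K} {a : A} :
    (a, (e : ℤ)) ∈ extendByInt K e q ↔ (a : A ⧸ K) = q := by
  rw [mem_extendByInt]
  constructor
  · rintro ⟨k, hk, hk'⟩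
    obtain rfl : k = 1 := by
      have : (e : ℤ) ≠ 0 := by exact_mod_cast he
      exact mul_right_cancel₀ this (by simpa using hk.symm)
    simpa using hk'
  · intro h
    exact ⟨1, by simp, by simpa using h⟩

theorem exists_eq_extendByInt (H : AddSubgroup (A × ℤ)) :
    ∃ (e : ℕ) (q : A ⧸ H.comap (AddMonoidHom.inl A ℤ)), H = extendByInt _ e q := by
  obtain ⟨e, he⟩ : ∃ e : ℕ, H.map (AddMonoidHom.snd A ℤ) = zmultiples (e : ℤ) := by
    obtain ⟨g, hg⟩ := Int.subgroup_cyclic (H.map (AddMonoidHom.snd A ℤ))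
    exact ⟨g.natAbs, by rw [hg, Int.zmultiples_natAbs, zmultiples_eq_closure]⟩
  obtain ⟨⟨x, -⟩, hx, rfl⟩ : (e : ℤ) ∈ H.map (AddMonoidHom.snd A ℤ) :=
    he ▸ mem_zmultiples _
  refine ⟨e, x, ?_⟩
  have key (a : A) (k : ℤ) : (a, k * (e : ℤ)) ∈ H ↔
      (a : A ⧸ H.comap (AddMonoidHom.inl A ℤ)) = k • (x : A ⧸ _) := by
    rw [← QuotientAddGroup.mk_zsmul, eq_comm, QuotientAddGroup.eq, mem_comap,
      ← add_mem_cancel_left (H.neg_mem (H.zsmul_mem hx k))]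
    simp
  ext ⟨a, z⟩
  rw [mem_extendByInt]
  constructor
  · intro h
    obtain ⟨k, rfl⟩ := mem_zmultiples_iff.1 (he ▸ mem_map_of_mem (AddMonoidHom.snd A ℤ) h)
    exact ⟨k, rfl, (key a k).1 h⟩
  · rintro ⟨k, rfl, h⟩
    exact (key a k).2 h

/-- Subgroups of index `n` in `A × ℤ` correspond to pairs of a subgroup of `A` whose index
divides `n` and a coset of it. -/
theorem nonempty_sigma_equiv_index_eq (A : Type*) [AddCommGroup A] {n : ℕ} (hn : n ≠ 0) :
    Nonempty ((Σ d : n.divisors, Σ K : {K : AddSubgroup A // K.index = d}, A ⧸ K.1) ≃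
      {H : AddSubgroup (A × ℤ) // H.index = n}) := by
  have hdiv {d : ℕ} (hd : d ∈ n.divisors) : n / d ≠ 0 :=
    (Nat.div_pos (Nat.divisor_le hd) (Nat.pos_of_mem_divisors hd)).ne'
  refine ⟨Equiv.ofBijective (fun t ↦ ⟨extendByInt t.2.1.1 (n / t.1) t.2.2, ?_⟩) ⟨?_, ?_⟩⟩
  · rw [index_extendByInt _ (hdiv t.1.2), t.2.1.2,
      Nat.mul_div_cancel' (Nat.dvd_of_mem_divisors t.1.2)]
  · rintro ⟨⟨d, hd⟩, ⟨K, hK⟩, q⟩ ⟨⟨d', hd'⟩, ⟨K', hK'⟩, q'⟩ h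
    change K.index = d at hK
    change K'.index = d' at hK'
    subst hK hK'
    replace h : extendByInt K (n / K.index) q = extendByInt K' (n / K'.index) q' :=
      congrArg Subtype.val h
    obtain rfl : K = K' := by
      rw [← comap_inl_extendByInt K (hdiv hd) q, h, comap_inl_extendByInt K' (hdiv hd')]
    obtain ⟨a, rfl⟩ := QuotientAddGroup.mk_surjective q
    obtain rfl := (mk_mem_extendByInt_iff (hdiv hd)).1
      (h ▸ (mk_mem_extendByInt_iff (hdiv hd)).2 rfl)
    rfl
  · rintro ⟨H, rfl⟩
    obtain ⟨e, q, h⟩ := H.exists_eq_extendByInt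
    have hindex : H.index = (H.comap (AddMonoidHom.inl A ℤ)).index * e := by
      conv_lhs => rw [index_eq_index_comap_inl_mul_index_map_snd, h, map_snd_extendByInt,
        Int.index_zmultiples, Int.natAbs_natCast, ← h]
    have hK : (H.comap (AddMonoidHom.inl A ℤ)).index ≠ 0 := by
      intro h0
      simp [hindex, h0] at hn
    refine ⟨⟨⟨_, Nat.mem_divisors.2 ⟨⟨e, hindex⟩, hn⟩⟩, ⟨_, rfl⟩, q⟩, Subtype.ext ?_⟩
    have hquot : H.index / (H.comap (AddMonoidHom.inl A ℤ)).index = e := by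
      rw [hindex, Nat.mul_div_cancel_left _ (Nat.pos_of_ne_zero hK)]
    simp only [hquot]
    exact h.symm

theorem finite_index_eq_prod_int
    (hA : ∀ m ≠ 0, Finite {K : AddSubgroup A // K.index = m}) {n : ℕ} (hn : n ≠ 0) :
    Finite {H : AddSubgroup (A × ℤ) // H.index = n} := by
  obtain ⟨f⟩ := nonempty_sigma_equiv_index_eq A hn
  have (d : n.divisors) := hA d (Nat.pos_of_mem_divisors d.2).ne'
  have (d : n.divisors) (K : {K : AddSubgroup A // K.index = d}) : Finite (A ⧸ K.1) :=
    Nat.finite_of_card_ne_zero (K.2.trans_ne (Nat.pos_of_mem_divisors d.2).ne')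
  exact .of_equiv _ f

theorem card_index_eq_prod_int
    (hA : ∀ m ≠ 0, Finite {K : AddSubgroup A // K.index = m}) {n : ℕ} (hn : n ≠ 0) :
    Nat.card {H : AddSubgroup (A × ℤ) // H.index = n} =
      ∑ d ∈ n.divisors, d * Nat.card {K : AddSubgroup A // K.index = d} := by
  obtain ⟨f⟩ := nonempty_sigma_equiv_index_eq A hn
  have (d : n.divisors) := hA d (Nat.pos_of_mem_divisors d.2).ne'
  have (d : n.divisors) (K : {K : AddSubgroup A // K.index = d}) : Finite (A ⧸ K.1) :=
    Nat.finite_of_card_ne_zero (K.2.trans_ne (Nat.pos_of_mem_divisors d.2).ne')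
  rw [← Nat.card_congr f, Nat.card_sigma,
    ← Finset.sum_coe_sort n.divisors fun d ↦ d * Nat.card {K : AddSubgroup A // K.index = d}]
  refine Finset.sum_congr rfl fun d _ ↦ ?_
  have := Fintype.ofFinite {K : AddSubgroup A // K.index = d}
  rw [Nat.card_sigma, Finset.sum_congr rfl fun K _ ↦ K.2]
  simp [mul_comm]

theorem card_index_eq_congr (f : A ≃+ B) (n : ℕ) :
    Nat.card {H : AddSubgroup A // H.index = n} = Nat.card {H : AddSubgroup B // H.index = n} :=
  Nat.card_congr <| f.mapAddSubgroup.toEquiv.subtypeEquiv fun H ↦ by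
    simp [index_map_equiv]

theorem card_index_eq_int (n : ℕ) :
    Nat.card {H : AddSubgroup ℤ // H.index = n} = 1 := by
  refine Nat.card_eq_one_iff_exists.2
    ⟨⟨zmultiples (n : ℤ), by simp [Int.index_zmultiples]⟩, fun ⟨H, hH⟩ ↦ Subtype.ext ?_⟩
  obtain ⟨g, rfl⟩ := Int.subgroup_cyclic H
  rw [← zmultiples_eq_closure, Int.index_zmultiples] at hH
  change closure {g} = zmultiples (n : ℤ)
  rw [← zmultiples_eq_closure, ← hH, Int.zmultiples_natAbs]

end AddSubgroup

open AddSubgroup in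
/-- The number of subgroups of `ℤ³` of index `p²` equals `1 + p + 2p² + p³ + p⁴`. -/
theorem stmt4 (p : ℕ) (hp : p.Prime) :
    Nat.card {H : AddSubgroup (Fin 3 → ℤ) // H.index = p ^ 2} =
      1 + p + 2 * p ^ 2 + p ^ 3 + p ^ 4 := by
  let f : (Fin 3 → ℤ) ≃+ (ℤ × ℤ) × ℤ :=
    { toFun := fun v ↦ ((v 0, v 1), v 2)
      invFun := fun x ↦ ![x.1.1, x.1.2, x.2]
      left_inv := fun v ↦ by ext i; fin_cases i <;> rfl
      right_inv := fun _ ↦ rfl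
      map_add' := fun _ _ ↦ rfl }
  have h₁ (m : ℕ) (_ : m ≠ 0) : Finite {K : AddSubgroup ℤ // K.index = m} :=
    Nat.finite_of_card_ne_zero (by simp [card_index_eq_int])
  have h₂ (m : ℕ) (hm : m ≠ 0) :
      Nat.card {K : AddSubgroup (ℤ × ℤ) // K.index = m} = ∑ d ∈ m.divisors, d := by
    rw [card_index_eq_prod_int h₁ hm]
    simp [card_index_eq_int]
  rw [card_index_eq_congr f,
    card_index_eq_prod_int (fun _ ↦ finite_index_eq_prod_int h₁) (pow_ne_zero 2 hp.ne_zero),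
    Finset.sum_congr rfl fun d hd ↦ by rw [h₂ d (Nat.pos_of_mem_divisors hd).ne']]
  simp only [Nat.sum_divisors_prime_pow hp, Finset.sum_range_succ, Finset.sum_range_zero]
  ring
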